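/- For each integer n ≥ 2, let θ_n be the unique positive real number satisfying tanh(θ_n/2) · tanh(n θ_n/2) = 1/n, and define v^{(n)} ∈ ℝ^n by v^{(n)}_k = cosh((k − (n+1)/2) θ_n) for 1 ≤ k ≤ n. Then lim_{n→∞} (Σ_{k=1}^n v^{(n)}_k) / (√n · (Σ_{k=1}^n (v^{(n)}_k)²)^{1/2}) = √2 · sinh(c) / (√c · √(c + cosh(c) sinh(c))), where c is the unique positive solution of c · tanh(c) = 1. -/

import Mathlib

open Finset Filter

/-- Telescoping sum of `cosh` over `n` equally spaced points centred at the origin. -/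
lemma sinh_mul_sum_cosh_centered (n : ℕ) (t : ℝ) :
    Real.sinh (t / 2) * ∑ k : Fin n, Real.cosh (((k : ℝ) + 1 - (n + 1) / 2) * t) =
      Real.sinh (n * t / 2) := by
  rw [Fin.sum_univ_eq_sum_range (fun k : ℕ => Real.cosh (((k : ℝ) + 1 - (n + 1) / 2) * t)),
    Finset.mul_sum]
  have telescoping : ∀ k ∈ range n,
      Real.sinh (t / 2) * Real.cosh (((k : ℝ) + 1 - (n + 1) / 2) * t) =
        Real.sinh (((k + 1 : ℕ) - (n : ℝ) / 2) * t) / 2 - Real.sinh ((k - (n : ℝ) / 2) * t) / 2 := by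
    intro k _
    have hright : ((k + 1 : ℕ) - (n : ℝ) / 2) * t =
        ((k : ℝ) + 1 - (n + 1) / 2) * t + t / 2 := by
      push_cast; ring
    have hleft : (k - (n : ℝ) / 2) * t = ((k : ℝ) + 1 - (n + 1) / 2) * t - t / 2 := by ring
    rw [hright, hleft, Real.sinh_add, Real.sinh_sub]
    ring
  rw [Finset.sum_congr rfl telescoping,
    Finset.sum_range_sub (fun k : ℕ => Real.sinh ((k - (n : ℝ) / 2) * t) / 2)]
  have hlast : ((n : ℝ) - n / 2) * t = n * t / 2 := by ring
  have hfirst : ((0 : ℕ) - (n : ℝ) / 2) * t = -(n * t / 2) := by push_cast; ring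
  rw [hlast, hfirst, Real.sinh_neg]
  ring

lemma sum_cosh_centered (n : ℕ) {t : ℝ} (ht : 0 < t) :
    ∑ k : Fin n, Real.cosh (((k : ℝ) + 1 - (n + 1) / 2) * t) =
      Real.sinh (n * t / 2) / Real.sinh (t / 2) := by
  have hs : 0 < Real.sinh (t / 2) := Real.sinh_pos_iff.2 (by positivity)
  rw [eq_div_iff hs.ne', mul_comm, sinh_mul_sum_cosh_centered]

lemma sum_cosh_sq_centered (n : ℕ) {t : ℝ} (ht : 0 < t) :
    ∑ k : Fin n, Real.cosh (((k : ℝ) + 1 - (n + 1) / 2) * t) ^ 2 =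
      n / 2 + Real.sinh (n * t) / (2 * Real.sinh t) := by
  have hdouble : ∀ k : Fin n, Real.cosh (((k : ℝ) + 1 - (n + 1) / 2) * t) ^ 2 =
      1 / 2 + Real.cosh (((k : ℝ) + 1 - (n + 1) / 2) * (2 * t)) / 2 := by
    intro k
    rw [mul_left_comm, Real.cosh_two_mul, Real.sinh_sq]
    ring
  have hsum := sum_cosh_centered n (mul_pos two_pos ht)
  rw [show (n : ℝ) * (2 * t) / 2 = n * t by ring, show 2 * t / 2 = t by ring] at hsum
  rw [Finset.sum_congr rfl fun k _ => hdouble k, Finset.sum_add_distrib,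
    ← Finset.sum_div univ (fun k : Fin n => Real.cosh (((k : ℝ) + 1 - (n + 1) / 2) * (2 * t))), hsum]
  simp only [sum_const, card_univ, Fintype.card_fin, nsmul_eq_mul]
  have hs : Real.sinh t ≠ 0 := (Real.sinh_pos_iff.2 ht).ne'
  field_simp

lemma tendsto_sinh_div_self :
    Tendsto (fun t : ℝ => Real.sinh t / t) (nhdsWithin 0 {0}ᶜ) (nhds 1) := by
  have h := (Real.hasDerivAt_sinh 0).tendsto_slope_zero
  simpa [div_eq_inv_mul] using h

lemma Real.tanh_strictMono : StrictMono Real.tanh := by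
  intro a b hab
  have h : 0 < Real.sinh (b - a) := Real.sinh_pos_iff.2 (sub_pos.2 hab)
  rw [Real.sinh_sub] at h
  rw [Real.tanh_eq_sinh_div_cosh, Real.tanh_eq_sinh_div_cosh,
    div_lt_div_iff₀ (Real.cosh_pos a) (Real.cosh_pos b)]
  linarith

lemma strictMonoOn_mul_tanh : StrictMonoOn (fun x : ℝ => x * Real.tanh x) (Set.Ici 0) := by
  intro a ha b hb hab
  have ha' : (0 : ℝ) ≤ a := ha
  have hmono : Real.tanh a < Real.tanh b := Real.tanh_strictMono hab
  have hnonneg : 0 ≤ Real.tanh a := by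
    simpa using Real.tanh_strictMono.monotone ha'
  exact mul_lt_mul'' hab hmono ha' hnonneg

/-- Convergence of the images under a strictly increasing function forces convergence of the
arguments to a point of `[0, ∞)`. -/
lemma tendsto_of_strictMonoOn_Ici {g : ℝ → ℝ} (hg : StrictMonoOn g (Set.Ici 0)) {x : ℕ → ℝ}
    {c : ℝ} (hc : 0 ≤ c) (hx : ∀ᶠ n in atTop, 0 ≤ x n)
    (h : Tendsto (fun n => g (x n)) atTop (nhds (g c))) : Tendsto x atTop (nhds c) := by
  refine tendsto_order.2 ⟨fun a ha => ?_, fun b hb => ?_⟩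
  · rcases lt_or_ge a 0 with ha0 | ha0
    · filter_upwards [hx] with n hn using ha0.trans_le hn
    · filter_upwards [hx, h.eventually (lt_mem_nhds (hg ha0 hc ha))] with n hn hlt
      exact (hg.lt_iff_lt ha0 hn).1 hlt
  · have hb0 : 0 ≤ b := hc.trans hb.le
    filter_upwards [hx, h.eventually (gt_mem_nhds (hg hc hb0 hb))] with n hn hlt
    exact (hg.lt_iff_lt hn hb0).1 hlt

section Parameter

variable {θ : ℕ → ℝ}

lemma tendsto_theta_div_two
    (hθ : ∀ n : ℕ, 2 ≤ n → 0 < θ n ∧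
      Real.tanh (θ n / 2) * Real.tanh (n * θ n / 2) = 1 / n) :
    Tendsto (fun n => θ n / 2) atTop (nhds 0) := by
  have hnonneg : ∀ᶠ n in atTop, 0 ≤ θ n / 2 := by
    filter_upwards [eventually_ge_atTop 2] with n hn
    exact (half_pos (hθ n hn).1).le
  have hsq : StrictMonoOn (fun x : ℝ => Real.tanh x ^ 2) (Set.Ici 0) := by
    intro a ha b _ hab
    have h0 : 0 ≤ Real.tanh a := by
      simpa using Real.tanh_strictMono.monotone (show (0 : ℝ) ≤ a from ha)
    exact pow_lt_pow_left₀ (Real.tanh_strictMono hab) h0 two_ne_zero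
  refine tendsto_of_strictMonoOn_Ici hsq le_rfl hnonneg ?_
  simp only [Real.tanh_zero, ne_eq, OfNat.ofNat_ne_zero, not_false_eq_true, zero_pow]
  refine squeeze_zero' (Eventually.of_forall fun n => sq_nonneg _) ?_
    tendsto_one_div_atTop_nhds_zero_nat
  filter_upwards [eventually_ge_atTop 2] with n hn
  obtain ⟨hpos, heq⟩ := hθ n hn
  have h0 : 0 ≤ Real.tanh (θ n / 2) := by
    simpa using Real.tanh_strictMono.monotone (half_pos hpos).le
  have hn1 : (1 : ℝ) ≤ n := by exact_mod_cast one_le_two.trans hn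
  have hle : Real.tanh (θ n / 2) ≤ Real.tanh (n * θ n / 2) :=
    Real.tanh_strictMono.monotone (by nlinarith)
  rw [← heq, sq]
  exact mul_le_mul_of_nonneg_left hle h0

lemma tendsto_sinh_theta_div
    (hθ : ∀ n : ℕ, 2 ≤ n → 0 < θ n ∧
      Real.tanh (θ n / 2) * Real.tanh (n * θ n / 2) = 1 / n) {a : ℝ} (ha : 0 < a) :
    Tendsto (fun n => Real.sinh (a * (θ n / 2)) / (a * (θ n / 2))) atTop (nhds 1) := by
  refine tendsto_sinh_div_self.comp (tendsto_nhdsWithin_iff.2 ⟨?_, ?_⟩)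
  · simpa using (tendsto_theta_div_two hθ).const_mul a
  · filter_upwards [eventually_ge_atTop 2] with n hn
    exact (mul_pos ha (half_pos (hθ n hn).1)).ne'

lemma tendsto_nat_mul_theta_div_two
    (hθ : ∀ n : ℕ, 2 ≤ n → 0 < θ n ∧
      Real.tanh (θ n / 2) * Real.tanh (n * θ n / 2) = 1 / n)
    {c : ℝ} (hc : 0 < c) (hc1 : c * Real.tanh c = 1) :
    Tendsto (fun n : ℕ => n * θ n / 2) atTop (nhds c) := by
  refine tendsto_of_strictMonoOn_Ici strictMonoOn_mul_tanh hc.le ?_ ?_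
  · filter_upwards [eventually_ge_atTop 2] with n hn
    have := (hθ n hn).1
    positivity
  · have hcosh : Tendsto (fun n => Real.cosh (θ n / 2)) atTop (nhds 1) := by
      simpa [Function.comp_def] using
        (Real.continuous_cosh.tendsto 0).comp (tendsto_theta_div_two hθ)
    have hlim := hcosh.div (tendsto_sinh_theta_div hθ one_pos) one_ne_zero
    simp only [hc1]
    rw [div_one] at hlim
    refine hlim.congr' ?_
    filter_upwards [eventually_ge_atTop 2] with n hn
    obtain ⟨hpos, heq⟩ := hθ n hn
    have hs : 0 < Real.sinh (θ n / 2) := Real.sinh_pos_iff.2 (half_pos hpos)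
    have hco := Real.cosh_pos (θ n / 2)
    have hn0 : (0 : ℝ) < n := by exact_mod_cast two_pos.trans_le hn
    rw [Real.tanh_eq_sinh_div_cosh (θ n / 2)] at heq
    have hT : Real.tanh (n * θ n / 2) =
        Real.cosh (θ n / 2) / (n * Real.sinh (θ n / 2)) := by
      rw [eq_div_iff (by positivity)]
      rw [div_mul_eq_mul_div, div_eq_div_iff hco.ne' hn0.ne'] at heq
      linear_combination heq
    simp only [Pi.div_apply, one_mul]
    rw [hT]
    field_simp

end Parameter

/-- Proposition 2: for the leading eigenvector
`v^{(n)}_k = cosh((k - (n+1)/2)θ_n)` of the distance matrix of the path graph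
`P_n` (with `θ_n` the unique positive solution of
`tanh(θ/2)·tanh(nθ/2) = 1/n`), the normalized inner product with the all-ones
vector converges to `√2·sinh c / (√c·√(c + cosh c · sinh c))`, where `c` is the
unique positive solution of `c·tanh c = 1`. -/
theorem path_graph_inner_limit (θ : ℕ → ℝ)
    (hθ : ∀ n : ℕ, 2 ≤ n → 0 < θ n ∧
      Real.tanh (θ n / 2) * Real.tanh (n * θ n / 2) = 1 / n)
    (c : ℝ) (hc : 0 < c) (hc1 : c * Real.tanh c = 1) :
    Tendsto (fun n : ℕ =>
        (∑ k : Fin n, Real.cosh (((k : ℝ) + 1 - (n + 1) / 2) * θ n)) /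
          (Real.sqrt n *
            Real.sqrt (∑ k : Fin n,
              Real.cosh (((k : ℝ) + 1 - (n + 1) / 2) * θ n) ^ 2)))
      atTop
      (nhds (Real.sqrt 2 * Real.sinh c /
        (Real.sqrt c * Real.sqrt (c + Real.cosh c * Real.sinh c)))) := by
  have hx := tendsto_nat_mul_theta_div_two hθ hc hc1
  have hsc : 0 < Real.sinh c := Real.sinh_pos_iff.2 hc
  have hcc := Real.cosh_pos c
  have hmean : Tendsto (fun n : ℕ =>
      (∑ k : Fin n, Real.cosh (((k : ℝ) + 1 - (n + 1) / 2) * θ n)) / n) atTop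
      (nhds (Real.sinh c / (c * 1))) := by
    refine (((Real.continuous_sinh.tendsto c).comp hx).div
      (hx.mul (tendsto_sinh_theta_div hθ one_pos)) (by simpa using hc.ne')).congr' ?_
    filter_upwards [eventually_ge_atTop 2] with n hn
    have hpos := (hθ n hn).1
    have hs : 0 < Real.sinh (θ n / 2) := Real.sinh_pos_iff.2 (half_pos hpos)
    have hn0 : (0 : ℝ) < n := by exact_mod_cast two_pos.trans_le hn
    rw [sum_cosh_centered n hpos]
    simp only [Pi.div_apply, Function.comp_apply, one_mul]
    field_simp
  have hmeansq : Tendsto (fun n : ℕ =>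
      (∑ k : Fin n, Real.cosh (((k : ℝ) + 1 - (n + 1) / 2) * θ n) ^ 2) / n) atTop
      (nhds (1 / 2 + Real.sinh (2 * c) / (4 * (c * 1)))) := by
    refine ((((Real.continuous_sinh.tendsto (2 * c)).comp (hx.const_mul 2)).div
      ((hx.mul (tendsto_sinh_theta_div hθ two_pos)).const_mul 4)
      (by simpa using hc.ne')).const_add (1 / 2)).congr' ?_
    filter_upwards [eventually_ge_atTop 2] with n hn
    have hpos := (hθ n hn).1
    have hs : 0 < Real.sinh (θ n) := Real.sinh_pos_iff.2 hpos
    have hn0 : (0 : ℝ) < n := by exact_mod_cast two_pos.trans_le hn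
    rw [sum_cosh_sq_centered n hpos]
    simp only [Pi.div_apply, Function.comp_apply]
    rw [show 2 * (n * θ n / 2) = n * θ n by ring, show 2 * (θ n / 2) = θ n by ring]
    field_simp
    ring
  have hvalue : 1 / 2 + Real.sinh (2 * c) / (4 * (c * 1)) =
      (c + Real.cosh c * Real.sinh c) / (2 * c) := by
    rw [Real.sinh_two_mul]
    field_simp
    ring
  rw [hvalue] at hmeansq
  have hlim := hmean.div ((Real.continuous_sqrt.tendsto _).comp hmeansq)
    (Real.sqrt_pos.2 (by positivity)).ne'
  have htarget : Real.sinh c / (c * 1) /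
      Real.sqrt ((c + Real.cosh c * Real.sinh c) / (2 * c)) =
      Real.sqrt 2 * Real.sinh c / (Real.sqrt c * Real.sqrt (c + Real.cosh c * Real.sinh c)) := by
    rw [Real.sqrt_div (by positivity), Real.sqrt_mul zero_le_two]
    have hroot : 0 < Real.sqrt (c + Real.cosh c * Real.sinh c) := Real.sqrt_pos.2 (by positivity)
    have hrootc : 0 < Real.sqrt c := Real.sqrt_pos.2 hc
    field_simp
    rw [Real.sq_sqrt hc.le]
  rw [htarget] at hlim
  refine hlim.congr' ?_
  filter_upwards [eventually_ge_atTop 2] with n hn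
  have hn0 : (0 : ℝ) < n := by exact_mod_cast two_pos.trans_le hn
  have hrootn : 0 < Real.sqrt n := Real.sqrt_pos.2 hn0
  simp only [Pi.div_apply, Function.comp_apply]
  rw [Real.sqrt_div (Finset.sum_nonneg fun k _ => sq_nonneg _), div_div, mul_div_assoc',
    div_eq_mul_inv, div_eq_mul_inv, mul_comm (n : ℝ), mul_div_assoc, Real.div_sqrt, mul_comm]
  ring
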